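/- Let J be a commutative (not necessarily associative) ℝ-algebra satisfying the Jordan identity x(x²y) = x²(xy). Then the linear span str(J) := span_ℝ{ S_{uv} : u, v ∈ J } of the operators S_{uv} := [L_u, L_v] + L_{uv} in End(J) is closed under the commutator bracket [T, T'] = TT' − T'T; that is, str(J) is a Lie subalgebra of gl(J). -/

import Mathlib

/-- The set of operators `S_{uv} = [L_u, L_v] + L_{uv}` on a Jordan algebra `J`. -/
def strSet (J : Type*) [NonUnitalNonAssocCommRing J] [Module ℝ J]
    [SMulCommClass ℝ J J] [IsScalarTower ℝ J J] : Set (Module.End ℝ J) :=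
  {T | ∃ u v : J, T = LinearMap.mulLeft ℝ u * LinearMap.mulLeft ℝ v
    - LinearMap.mulLeft ℝ v * LinearMap.mulLeft ℝ u + LinearMap.mulLeft ℝ (u * v)}

section JordanIdentities

variable {J : Type*} [NonUnitalNonAssocCommRing J] [Module ℝ J]

/-- The full linearization of the Jordan identity. -/
theorem jordan_linearized (jordan : ∀ x y : J, x * (x * x * y) = x * x * (x * y))
    (a b c z : J) :
    a * (b * c * z) + b * (c * a * z) + c * (a * b * z) =
      b * c * (a * z) + c * a * (b * z) + a * b * (c * z) := by
  have : IsCommJordan J := ⟨fun x y => by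
    rw [mul_comm (x * y), ← jordan, mul_comm (x * x)]⟩
  have h : 2 • (a * (b * c * z) - b * c * (a * z) + (b * (c * a * z) - c * a * (b * z)) +
      (c * (a * b * z) - a * b * (c * z))) = 0 :=
    DFunLike.congr_fun (two_nsmul_lie_lmul_lmul_add_add_eq_zero a b c) z
  rw [← Nat.cast_smul_eq_nsmul ℝ, smul_eq_zero_iff_right (by simp)] at h
  rw [← sub_eq_zero, ← h]
  abel

/-- The commutator of two left multiplications is a derivation of a Jordan algebra. -/
theorem jordan_inner_derivation (jordan : ∀ x y : J, x * (x * x * y) = x * x * (x * y))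
    (u v w z : J) :
    u * (v * (w * z)) - v * (u * (w * z)) =
      (u * (v * w) - v * (u * w)) * z + w * (u * (v * z) - v * (u * z)) := by
  have h₁ := jordan_linearized jordan u w z v
  have h₂ := jordan_linearized jordan v w z u
  have h : w * z * (u * v) + z * u * (w * v) + u * w * (z * v) =
      w * z * (v * u) + z * v * (w * u) + v * w * (z * u) := by
    rw [mul_comm v u, mul_comm (z * v), mul_comm (v * w), mul_comm u w, mul_comm v w]
    abel
  rw [← h₁, ← h₂, mul_comm (w * z) v, mul_comm (z * u) v, mul_comm z u, mul_comm (u * w) v,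
    mul_comm (w * z) u, mul_comm (z * v) u, mul_comm z v, mul_comm (v * w) u, ← sub_eq_zero] at h
  rw [mul_comm (_ - _) z, mul_sub, mul_sub, ← sub_eq_zero, ← h]
  abel

end JordanIdentities

section StructureAlgebra

variable {J : Type*} [NonUnitalNonAssocCommRing J] [Module ℝ J]
  [SMulCommClass ℝ J J]

attribute [local instance] LieRing.ofAssociativeRing LieAlgebra.ofAssociativeAlgebra

local notation "L" => LinearMap.mulLeft ℝ

theorem lie_lie_mulLeft (jordan : ∀ x y : J, x * (x * x * y) = x * x * (x * y)) (u v w : J) :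
    ⁅⁅L u, L v⁆, L w⁆ = L (u * (v * w)) - L (v * (u * w)) := by
  ext z
  have h := jordan_inner_derivation jordan u v w z
  simp only [Ring.lie_def, LinearMap.sub_apply, Module.End.mul_apply, LinearMap.mulLeft_apply]
  rw [h, sub_mul]
  abel

variable [IsScalarTower ℝ J J]

theorem mulLeft_mul_mem_span_strSet (u v : J) :
    L (u * v) ∈ Submodule.span ℝ (strSet J) := by
  have h₁ : _ ∈ Submodule.span ℝ (strSet J) := Submodule.subset_span ⟨u, v, rfl⟩
  have h₂ : _ ∈ Submodule.span ℝ (strSet J) := Submodule.subset_span ⟨v, u, rfl⟩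
  convert Submodule.smul_mem _ (1 / 2 : ℝ) (Submodule.add_mem _ h₁ h₂) using 1
  rw [mul_comm v u]
  module

theorem lie_mulLeft_mem_span_strSet (u v : J) :
    ⁅L u, L v⁆ ∈ Submodule.span ℝ (strSet J) := by
  have h : _ ∈ Submodule.span ℝ (strSet J) := Submodule.subset_span ⟨u, v, rfl⟩
  rw [Ring.lie_def]
  simpa using Submodule.sub_mem _ h (mulLeft_mul_mem_span_strSet u v)

theorem lie_lie_mulLeft_mem_span_strSet
    (jordan : ∀ x y : J, x * (x * x * y) = x * x * (x * y)) (u v w : J) :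
    ⁅⁅L u, L v⁆, L w⁆ ∈ Submodule.span ℝ (strSet J) := by
  rw [lie_lie_mulLeft jordan]
  exact Submodule.sub_mem _ (mulLeft_mul_mem_span_strSet _ _) (mulLeft_mul_mem_span_strSet _ _)

theorem lie_lie_lie_mulLeft_mem_span_strSet
    (jordan : ∀ x y : J, x * (x * x * y) = x * x * (x * y)) (u v w z : J) :
    ⁅⁅L u, L v⁆, ⁅L w, L z⁆⁆ ∈ Submodule.span ℝ (strSet J) := by
  rw [leibniz_lie ⁅L u, L v⁆, lie_lie_mulLeft jordan, lie_lie_mulLeft jordan, sub_lie, lie_sub]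
  exact Submodule.add_mem _
    (Submodule.sub_mem _ (lie_mulLeft_mem_span_strSet _ _) (lie_mulLeft_mem_span_strSet _ _))
    (Submodule.sub_mem _ (lie_mulLeft_mem_span_strSet _ _) (lie_mulLeft_mem_span_strSet _ _))

theorem lie_mem_span_strSet_of_mem (jordan : ∀ x y : J, x * (x * x * y) = x * x * (x * y))
    {T T' : Module.End ℝ J} (hT : T ∈ strSet J) (hT' : T' ∈ strSet J) :
    ⁅T, T'⁆ ∈ Submodule.span ℝ (strSet J) := by
  obtain ⟨u, v, rfl⟩ := hT
  obtain ⟨w, z, rfl⟩ := hT'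
  rw [← Ring.lie_def, ← Ring.lie_def, add_lie, lie_add, lie_add, ← lie_skew (L (u * v))]
  exact Submodule.add_mem _
    (Submodule.add_mem _ (lie_lie_lie_mulLeft_mem_span_strSet jordan u v w z)
      (lie_lie_mulLeft_mem_span_strSet jordan u v (w * z)))
    (Submodule.add_mem _
      (Submodule.neg_mem _ (lie_lie_mulLeft_mem_span_strSet jordan w z (u * v)))
      (lie_mulLeft_mem_span_strSet _ _))

theorem lie_mem_span_strSet (jordan : ∀ x y : J, x * (x * x * y) = x * x * (x * y))
    {T T' : Module.End ℝ J} (hT : T ∈ Submodule.span ℝ (strSet J))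
    (hT' : T' ∈ Submodule.span ℝ (strSet J)) :
    ⁅T, T'⁆ ∈ Submodule.span ℝ (strSet J) := by
  induction hT, hT' using Submodule.span_induction₂ with
  | mem_mem T T' hT hT' => exact lie_mem_span_strSet_of_mem jordan hT hT'
  | zero_left => simp
  | zero_right => simp
  | add_left _ _ _ _ _ _ h₁ h₂ => rw [add_lie]; exact Submodule.add_mem _ h₁ h₂
  | add_right _ _ _ _ _ _ h₁ h₂ => rw [lie_add]; exact Submodule.add_mem _ h₁ h₂
  | smul_left r _ _ _ _ h => rw [smul_lie]; exact Submodule.smul_mem _ r h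
  | smul_right r _ _ _ _ h => rw [lie_smul]; exact Submodule.smul_mem _ r h

end StructureAlgebra

/-- For a real Jordan algebra `J`, the structure algebra
`str(J) = span_ℝ { S_{uv} : u, v ∈ J }` is closed under the commutator bracket,
i.e. it is a Lie subalgebra of `gl(J)`. -/
theorem stmt2 (J : Type*) [NonUnitalNonAssocCommRing J] [Module ℝ J]
    [SMulCommClass ℝ J J] [IsScalarTower ℝ J J]
    (jordan : ∀ x y : J, x * (x * x * y) = x * x * (x * y)) :
    ∀ T ∈ Submodule.span ℝ (strSet J), ∀ T' ∈ Submodule.span ℝ (strSet J),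
      T * T' - T' * T ∈ Submodule.span ℝ (strSet J) := by
  intro T hT T' hT'
  rw [← Ring.lie_def]
  exact lie_mem_span_strSet jordan hT hT'
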